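/- Let W(x) = (x−1)^4 (x^2 + Sx + S^2/4)(x^2 + Mx + N) with real numbers S, M, N satisfying 3 − √5 < S < 8 − 2√10 and N ≥ M^2/4. Then W does not define any of the sign patterns (+,−,−,+,−,+,−,+,+), (+,−,−,+,−,+,+,+,+), or (+,−,−,−,−,+,−,+,+). -/

import Mathlib

open Polynomial

/-- A degree-8 real polynomial `P` defines the sign pattern `σ = (σ_0, …, σ_8)`
(with entries `1` for `+`, `-1` for `−`) if for each `j` the coefficient of
`x^(8-j)` is nonzero and has sign `σ_j`. -/
def definesSignPattern (P : Polynomial ℝ) (σ : Fin 9 → ℝ) : Prop :=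
  ∀ j : Fin 9, Real.sign (P.coeff (8 - (j : ℕ))) = σ j

theorem Real.pos_of_sign_eq_one {r : ℝ} (h : Real.sign r = 1) : 0 < r := by
  by_contra hr
  rcases (not_lt.mp hr).lt_or_eq with h' | h'
  · rw [Real.sign_of_neg h'] at h; norm_num at h
  · simp [h'] at h

theorem Real.neg_of_sign_eq_neg_one {r : ℝ} (h : Real.sign r = -1) : r < 0 := by
  by_contra hr
  rcases (not_lt.mp hr).lt_or_eq with h' | h'
  · rw [Real.sign_of_pos h'] at h; norm_num at h
  · simp [← h'] at h

theorem sub_one_pow_four_mul_quadratics_eq (S q M N : ℝ) :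
    (X - 1) ^ 4 * (X ^ 2 + C S * X + C q) * (X ^ 2 + C M * X + C N) =
      X ^ 8 + C (S - 4 + M) * X ^ 7 + C (6 - 4 * S + q + M * (S - 4) + N) * X ^ 6 +
      C (-4 + 6 * S - 4 * q + M * (6 - 4 * S + q) + N * (S - 4)) * X ^ 5 +
      C (1 - 4 * S + 6 * q + M * (-4 + 6 * S - 4 * q) + N * (6 - 4 * S + q)) * X ^ 4 +
      C (S - 4 * q + M * (1 - 4 * S + 6 * q) + N * (-4 + 6 * S - 4 * q)) * X ^ 3 +
      C (q + M * (S - 4 * q) + N * (1 - 4 * S + 6 * q)) * X ^ 2 +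
      C (M * q + N * (S - 4 * q)) * X + C (N * q) := by
  simp only [map_add, map_sub, map_mul, map_neg, map_ofNat, map_one]
  ring

/-- The signs of the coefficients of `x⁶`, `x⁴`, `x³` and `x` shared by the three patterns
are already incompatible. -/
theorem coeff_signs_incompatible {S M N : ℝ} (hS : 3 - Real.sqrt 5 < S)
    (hS' : S < 8 - 2 * Real.sqrt 10) (hN : M ^ 2 / 4 ≤ N)
    (h6 : 6 - 4 * S + S ^ 2 / 4 + M * (S - 4) + N < 0)
    (h4 : 1 - 4 * S + 6 * (S ^ 2 / 4) + M * (-4 + 6 * S - 4 * (S ^ 2 / 4)) +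
      N * (6 - 4 * S + S ^ 2 / 4) < 0)
    (h3 : 0 < S - 4 * (S ^ 2 / 4) + M * (1 - 4 * S + 6 * (S ^ 2 / 4)) +
      N * (-4 + 6 * S - 4 * (S ^ 2 / 4)))
    (h1 : 0 < M * (S ^ 2 / 4) + N * (S - 4 * (S ^ 2 / 4))) : False := by
  have sqrt5_lt : Real.sqrt 5 < 2.24 := by
    rw [Real.sqrt_lt' (by norm_num)]; norm_num
  have lt_sqrt10 : 3.162 < Real.sqrt 10 := by
    rw [Real.lt_sqrt (by norm_num)]; norm_num
  have lo : 0.76 < S := by linarith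
  have hi : S < 1.676 := by linarith
  have hN0 : 0 ≤ N := le_trans (by positivity) hN
  have ha4 : 0 < 6 - 4 * S + S ^ 2 / 4 := by
    nlinarith [Real.sq_sqrt (show (0 : ℝ) ≤ 10 by norm_num)]
  have hM : 0 < M := by
    by_contra h
    nlinarith [mul_nonneg (neg_nonneg.mpr (not_lt.mp h)) (show 0 ≤ 4 - S by linarith)]
  have infeasible : ∀ α β γ : ℝ, 0 ≤ α → 0 ≤ β → 0 ≤ γ →
      S - S ^ 2 - α * (6 - 4 * S + S ^ 2 / 4) - β * (1 - 4 * S + 6 * (S ^ 2 / 4)) ≤ 0 →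
      1 - 4 * S + 6 * (S ^ 2 / 4) - α * (S - 4) - β * (-4 + 6 * S - S ^ 2)
        + γ * (S ^ 2 / 4) ≤ 0 →
      -4 + 6 * S - S ^ 2 - α - β * (6 - 4 * S + S ^ 2 / 4) + γ * (S - S ^ 2) ≤ 0 → False := by
    intro α β γ hα hβ hγ e0 eM eN
    linarith [mul_nonneg hα (neg_nonneg.mpr h6.le), mul_nonneg hβ (neg_nonneg.mpr h4.le),
      mul_nonneg hγ h1.le, mul_nonneg hM.le (neg_nonneg.mpr eM),
      mul_nonneg hN0 (neg_nonneg.mpr eN)]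
  rcases le_total S 1.044 with h | h
  · apply infeasible 0.3 0.4 1.25 <;>
      linarith [mul_nonneg (sub_nonneg.mpr lo.le) (sub_nonneg.mpr h), sq_nonneg (S - 1.044)]
  · apply infeasible 0.4 0.5 3 <;>
      linarith [mul_nonneg (sub_nonneg.mpr hi.le) (sub_nonneg.mpr h), sq_nonneg (S - 1.24),
        sq_nonneg (S - 1.33)]

theorem not_definesSignPattern_of_signs {S M N : ℝ} (hS : 3 - Real.sqrt 5 < S)
    (hS' : S < 8 - 2 * Real.sqrt 10) (hN : M ^ 2 / 4 ≤ N) {σ : Fin 9 → ℝ}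
    (σ2 : σ 2 = -1) (σ4 : σ 4 = -1) (σ5 : σ 5 = 1) (σ7 : σ 7 = 1) :
    ¬ definesSignPattern ((X - 1) ^ 4 * (X ^ 2 + C S * X + C (S ^ 2 / 4)) *
      (X ^ 2 + C M * X + C N)) σ := by
  intro h
  rw [sub_one_pow_four_mul_quadratics_eq] at h
  refine coeff_signs_incompatible hS hS' hN (Real.neg_of_sign_eq_neg_one ?_)
    (Real.neg_of_sign_eq_neg_one ?_) (Real.pos_of_sign_eq_one ?_) (Real.pos_of_sign_eq_one ?_)
  · simpa [coeff_X_pow, coeff_X, coeff_C, -map_add, -map_sub, -map_mul] using (h 2).trans σ2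
  · simpa [coeff_X_pow, coeff_X, coeff_C, -map_add, -map_sub, -map_mul] using (h 4).trans σ4
  · simpa [coeff_X_pow, coeff_X, coeff_C, -map_add, -map_sub, -map_mul] using (h 5).trans σ5
  · simpa [coeff_X_pow, coeff_X, coeff_C, -map_add, -map_sub, -map_mul] using (h 7).trans σ7

/-- For `S` in the given range and `N ≥ M²/4`, the polynomial
`W = (x−1)⁴ (x² + Sx + S²/4)(x² + Mx + N)` does not define any of the sign
patterns (+,−,−,+,−,+,−,+,+), (+,−,−,+,−,+,+,+,+), (+,−,−,−,−,+,−,+,+). -/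
theorem stmt18 (S M N : ℝ) (hS : 3 - Real.sqrt 5 < S) (hS' : S < 8 - 2 * Real.sqrt 10) (hN : M ^ 2 / 4 ≤ N) :
    ¬ definesSignPattern
        ((X - 1) ^ 4 * (X ^ 2 + C S * X + C (S ^ 2 / 4)) *
          (X ^ 2 + C M * X + C N)) ![1, -1, -1, 1, -1, 1, -1, 1, 1] ∧
    ¬ definesSignPattern
        ((X - 1) ^ 4 * (X ^ 2 + C S * X + C (S ^ 2 / 4)) *
          (X ^ 2 + C M * X + C N)) ![1, -1, -1, 1, -1, 1, 1, 1, 1] ∧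
    ¬ definesSignPattern
        ((X - 1) ^ 4 * (X ^ 2 + C S * X + C (S ^ 2 / 4)) *
          (X ^ 2 + C M * X + C N)) ![1, -1, -1, -1, -1, 1, -1, 1, 1] := by
  exact ⟨not_definesSignPattern_of_signs hS hS' hN rfl rfl rfl rfl,
    not_definesSignPattern_of_signs hS hS' hN rfl rfl rfl rfl,
    not_definesSignPattern_of_signs hS hS' hN rfl rfl rfl rfl⟩
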